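/- Let n ∈ ℕ, let K ⊆ ℝⁿ be a nonempty closed convex set, and let v : ℝⁿ → ℝⁿ be a Lipschitz vector field satisfying the inward-pointing condition: for every x ∈ K and every outward normal vector ν to K at x (i.e., every ν ∈ ℝⁿ with ⟪ν, z − x⟫ ≤ 0 for all z ∈ K), one has ⟪v(x), ν⟫ ≤ 0. Then K is viable for the flow of v: every continuously differentiable curve y : [0,∞) → ℝⁿ with y′(t) = v(y(t)) for all t ≥ 0 and y(0) ∈ K satisfies y(t) ∈ K for all t ≥ 0. -/

import Mathlib

open Set
open scoped RealInnerProductSpace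

open Filter Topology Metric

/-- Every point has a nearest point in a nonempty closed convex set, and the displacement from it
is an outward normal there. -/
theorem exists_infDist_eq_norm_sub_and_inner_nonpos {E : Type*} [NormedAddCommGroup E]
    [InnerProductSpace ℝ E] [CompleteSpace E] {K : Set E} (hne : K.Nonempty) (hK : IsClosed K)
    (hconv : Convex ℝ K) (x : E) :
    ∃ p ∈ K, infDist x K = ‖x - p‖ ∧ ∀ z ∈ K, ⟪x - p, z - p⟫ ≤ 0 := by
  obtain ⟨p, hp, h⟩ := exists_norm_eq_iInf_of_complete_convex hne hK.isComplete hconv x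
  refine ⟨p, hp, ?_, (norm_eq_iInf_iff_real_inner_le_zero hconv hp).1 h⟩
  simp only [infDist_eq_iInf, dist_eq_norm, h]

/-- If the velocity of a curve at time `t` satisfies `⟪y t - p, y' t⟫ ≤ c` for a nearest point
`p ∈ K` to `y t`, then the right slopes of the squared distance to `K` are eventually less than
any `r > 2 * c`. -/
theorem eventually_slope_infDist_sq_lt {E : Type*} [NormedAddCommGroup E]
    [InnerProductSpace ℝ E] {K : Set E} {y : ℝ → E} {y' p : E} {t c r : ℝ}
    (hy : HasDerivWithinAt y y' (Ioi t) t) (hp : p ∈ K) (hdist : infDist (y t) K = ‖y t - p‖)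
    (hc : ⟪y t - p, y'⟫ ≤ c) (hr : 2 * c < r) :
    ∀ᶠ z in 𝓝[>] t, (z - t)⁻¹ * (infDist (y z) K ^ 2 - infDist (y t) K ^ 2) < r := by
  have hg := (hy.sub_const p).norm_sq
  rw [hasDerivWithinAt_iff_tendsto_slope' self_notMem_Ioi] at hg
  filter_upwards [hg.eventually_lt_const (show 2 * ⟪y t - p, y'⟫ < r by linarith),
    self_mem_nhdsWithin] with z hz htz
  rw [slope_def_module, smul_eq_mul] at hz
  refine lt_of_le_of_lt ?_ hz
  have hzt : 0 ≤ (z - t)⁻¹ := inv_nonneg.2 (sub_nonneg.2 (le_of_lt htz))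
  have hle : infDist (y z) K ≤ ‖y z - p‖ := by
    simpa only [dist_eq_norm] using infDist_le_dist_of_mem hp
  rw [hdist]
  gcongr
  exact infDist_nonneg

/-- Nagumo-type invariance: a nonempty closed convex set `K ⊆ ℝⁿ` is
viable for the flow of a Lipschitz vector field `v` satisfying the inward-pointing
condition `⟪v(x), ν⟫ ≤ 0` for every outward normal `ν` to `K` at every `x ∈ K`. -/
theorem convex_set_viable (n : ℕ) (K : Set (EuclideanSpace ℝ (Fin n)))
    (hKne : K.Nonempty) (hKclosed : IsClosed K) (hKconv : Convex ℝ K)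
    (v : EuclideanSpace ℝ (Fin n) → EuclideanSpace ℝ (Fin n))
    (hvlip : ∃ L : NNReal, LipschitzWith L v)
    (hinward : ∀ x ∈ K, ∀ ν : EuclideanSpace ℝ (Fin n),
      (∀ z ∈ K, ⟪ν, z - x⟫ ≤ 0) → ⟪v x, ν⟫ ≤ 0)
    (y : ℝ → EuclideanSpace ℝ (Fin n))
    (hy : ∀ t : ℝ, 0 ≤ t → HasDerivWithinAt y (v (y t)) (Ici 0) t)
    (hy0 : y 0 ∈ K) :
    ∀ t : ℝ, 0 ≤ t → y t ∈ K := by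
  obtain ⟨L, hL⟩ := hvlip
  intro T hT
  have hcont : ContinuousOn (fun t ↦ infDist (y t) K ^ 2) (Icc 0 T) := by
    have hyc : ContinuousOn y (Icc 0 T) := fun t ht ↦
      (hy t ht.1).continuousWithinAt.mono Icc_subset_Ici_self
    exact ((continuous_infDist_pt K).comp_continuousOn hyc).pow 2
  have hslope : ∀ t ∈ Ico 0 T, ∀ r, 2 * (L * infDist (y t) K ^ 2) < r →
      ∃ᶠ z in 𝓝[>] t, (z - t)⁻¹ * (infDist (y z) K ^ 2 - infDist (y t) K ^ 2) < r := by
    intro t ht r hr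
    obtain ⟨p, hp, hdist, hnormal⟩ :=
      exists_infDist_eq_norm_sub_and_inner_nonpos hKne hKclosed hKconv (y t)
    refine (eventually_slope_infDist_sq_lt ((hy t ht.1).mono (Ioi_subset_Ici ht.1)) hp hdist
      ?_ hr).frequently
    have hvp : ⟪y t - p, v p⟫ ≤ 0 := by
      rw [real_inner_comm]
      exact hinward p hp _ hnormal
    calc ⟪y t - p, v (y t)⟫
        = ⟪y t - p, v (y t) - v p⟫ + ⟪y t - p, v p⟫ := by rw [inner_sub_right]; ring
      _ ≤ ‖y t - p‖ * ‖v (y t) - v p‖ + 0 := add_le_add (real_inner_le_norm _ _) hvp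
      _ ≤ ‖y t - p‖ * (L * ‖y t - p‖) + 0 := by gcongr; exact hL.norm_sub_le _ _
      _ = L * infDist (y t) K ^ 2 := by rw [hdist]; ring
  have hbound := le_gronwallBound_of_liminf_deriv_right_le (δ := 0) (K := 2 * L) (ε := 0)
    hcont hslope (by simp [infDist_zero_of_mem hy0]) (fun t _ ↦ by linarith) T ⟨hT, le_rfl⟩
  rw [gronwallBound_ε0_δ0] at hbound
  rw [hKclosed.mem_iff_infDist_zero hKne]
  exact pow_eq_zero_iff two_ne_zero |>.1 (le_antisymm hbound (sq_nonneg _))
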